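/- arXiv:2411.16743 — 3 statements merged into one kernel-verified Lean document; each statement's English description precedes it below -/
import Mathlib

section
/- Let f : Q → ℝ, δ ≥ 0, L > 0, γ ∈ (1,2], and suppose (f_δ, g_δ) is a (δ,L)-oracle of f on Q and V satisfies the triangular scaling property with factor γ. Define g(x|y) := f_δ(y) + ⟨g_δ(y), x − y⟩ and θ_k := γ/(k+γ) for k ≥ 0. Let x* ∈ Q minimize f over Q. Suppose sequences (x_k)_{0≤k≤N}, (y_k)_{0≤k≤N−1}, (z_k)_{0≤k≤N} in Q satisfy z_0 = x_0 and, for every 0 ≤ k ≤ N−1: y_k = (1−θ_k)·x_k + θ_k·z_k, z_{k+1} minimizes z ↦ g(z|y_k) + θ_k^{γ−1}·L·V(z, z_k) over Q, and x_{k+1} = (1−θ_k)·x_k + θ_k·z_{k+1}. Then for every N ≥ 1: f(x_N) − f(x*) ≤ (γ/(γ+N−1))^γ · L · V(x*, x_0) + δ·N. -/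
open RealInnerProductSpace

section Bregman

variable {E : Type*} [NormedAddCommGroup E] [InnerProductSpace ℝ E]

theorem HasDerivAt.nonneg_of_forall_le {φ : ℝ → ℝ} {φ' : ℝ} (h : HasDerivAt φ φ' 0)
    (hle : ∀ t ∈ Set.Ioc (0 : ℝ) 1, φ 0 ≤ φ t) : 0 ≤ φ' := by
  refine ge_of_tendsto h.tendsto_slope_zero_right ?_
  filter_upwards [Ioc_mem_nhdsGT (zero_lt_one' ℝ)] with t ht
  rw [zero_add, smul_eq_mul]
  exact mul_nonneg (inv_nonneg.2 ht.1.le) (sub_nonneg.2 (hle t ht))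

variable [CompleteSpace E]

theorem Differentiable.hasDerivAt_line {d : E → ℝ} (hd : Differentiable ℝ d) (y v : E) :
    HasDerivAt (fun t : ℝ => d (y + t • v)) ⟪gradient d y, v⟫ 0 := by
  have hline : HasDerivAt (fun t : ℝ => y + t • v) v 0 := by
    simpa using ((hasDerivAt_id (0 : ℝ)).smul_const v).const_add y
  have hgrad : HasFDerivAt d (InnerProductSpace.toDual ℝ E (gradient d y))
      (y + (0 : ℝ) • v) := by
    simpa using (hd y).hasGradientAt.hasFDerivAt
  simpa [Function.comp_def] using hgrad.comp_hasDerivAt (0 : ℝ) hline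

theorem ConvexOn.bregman_nonneg {d : E → ℝ} (hdconv : ConvexOn ℝ Set.univ d)
    (hd : Differentiable ℝ d) (x y : E) : 0 ≤ d x - d y - ⟪gradient d y, x - y⟫ := by
  have hderiv : HasDerivAt (fun t : ℝ => t * (d x - d y) - d (y + t • (x - y)))
      (d x - d y - ⟪gradient d y, x - y⟫) 0 := by
    simpa using ((hasDerivAt_id (0 : ℝ)).mul_const (d x - d y)).fun_sub
      (hd.hasDerivAt_line y (x - y))
  refine hderiv.nonneg_of_forall_le fun t ht => ?_
  have hc := hdconv.2 (Set.mem_univ y) (Set.mem_univ x) (sub_nonneg.2 ht.2) ht.1.le (by ring)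
  rw [show (1 - t) • y + t • x = y + t • (x - y) by module, smul_eq_mul, smul_eq_mul] at hc
  simp only [zero_mul, zero_smul, add_zero]
  linarith

/-- The three-point inequality for a minimizer `p` of a linear function plus a multiple of the
Bregman divergence centred at `q`. -/
theorem bregman_three_point {Q : Set E} (hQ : Convex ℝ Q) {d : E → ℝ} (hd : Differentiable ℝ d)
    {V : E → E → ℝ} (hV : ∀ x y, V x y = d x - d y - ⟪gradient d y, x - y⟫)
    {g y p q : E} {c : ℝ} (hp : p ∈ Q)
    (hmin : ∀ z ∈ Q, ⟪g, p - y⟫ + c * V p q ≤ ⟪g, z - y⟫ + c * V z q) {z : E} (hz : z ∈ Q) :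
    ⟪g, p - y⟫ + c * V p q + c * V z p ≤ ⟪g, z - y⟫ + c * V z q := by
  have hderiv : HasDerivAt (fun t : ℝ => t * (⟪g, z - p⟫ - c * ⟪gradient d q, z - p⟫)
      + c * d (p + t • (z - p)))
      (⟪g, z - p⟫ - c * ⟪gradient d q, z - p⟫ + c * ⟪gradient d p, z - p⟫) 0 := by
    simpa using ((hasDerivAt_id (0 : ℝ)).mul_const
      (⟪g, z - p⟫ - c * ⟪gradient d q, z - p⟫)).fun_add
      ((hd.hasDerivAt_line p (z - p)).const_mul c)
  have hnonneg := hderiv.nonneg_of_forall_le fun t ht => by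
    have hm := hmin _ (hQ.add_smul_sub_mem hp hz ⟨ht.1.le, ht.2⟩)
    simp only [hV, inner_sub_right, inner_add_right, inner_smul_right] at hm ⊢
    simp only [zero_mul, zero_smul, add_zero]
    linarith
  simp only [hV, inner_sub_right] at hnonneg ⊢
  linarith

end Bregman

theorem mul_rpow_le_rpow_of_one_lt {γ : ℝ} (hγ : 1 < γ) {k : ℝ} (hk : 0 ≤ k) :
    k * (k + γ) ^ (γ - 1) ≤ (k + γ - 1) ^ γ := by
  have hγ0 : 0 < γ := by linarith
  have hkγ : 0 ≤ k + γ := by linarith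
  have hamgm := Real.geom_mean_le_arith_mean2_weighted (w₁ := 1 / γ) (w₂ := (γ - 1) / γ)
    (by positivity) (div_nonneg (by linarith) hγ0.le) hk hkγ (by field_simp; ring)
  rw [show 1 / γ * k + (γ - 1) / γ * (k + γ) = k + γ - 1 by field_simp; ring] at hamgm
  have hpow := Real.rpow_le_rpow (by positivity) hamgm hγ0.le
  rwa [Real.mul_rpow (by positivity) (by positivity), ← Real.rpow_mul hk, ← Real.rpow_mul hkγ,
    one_div_mul_cancel hγ0.ne', div_mul_cancel₀ _ hγ0.ne', Real.rpow_one] at hpow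

theorem one_sub_div_mul_rpow_le {γ : ℝ} (hγ : 1 < γ) {k : ℝ} (hk : 0 ≤ k) :
    (1 - γ / (k + γ)) * (γ / (k + γ - 1)) ^ γ ≤ (γ / (k + γ)) ^ γ := by
  have hγ0 : 0 < γ := by linarith
  have hkγ : 0 < k + γ := by linarith
  have hkγ1 : 0 < k + γ - 1 := by linarith
  have hpow := mul_rpow_le_rpow_of_one_lt hγ hk
  rw [Real.rpow_sub_one hkγ.ne', mul_div_assoc', div_le_iff₀ hkγ] at hpow
  rw [Real.div_rpow hγ0.le hkγ1.le, Real.div_rpow hγ0.le hkγ.le,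
    show 1 - γ / (k + γ) = k / (k + γ) by field_simp; ring, div_mul_div_comm,
    div_le_div_iff₀ (by positivity) (by positivity)]
  have hγγ : 0 ≤ γ ^ γ := by positivity
  nlinarith [mul_le_mul_of_nonneg_left hpow hγγ]


/-- Theorem 4.1 (convergence rate of the non-adaptive accelerated Bregman proximal gradient
method with a `(δ,L)`-oracle):
`f(x_N) − f(x*) ≤ (γ/(γ+N−1))^γ · L · V(x*,x_0) + δ·N`. -/
theorem stmt_7
    {E : Type*} [NormedAddCommGroup E] [InnerProductSpace ℝ E] [CompleteSpace E]
    (Q : Set E) (hQne : Q.Nonempty) (hQclosed : IsClosed Q) (hQconv : Convex ℝ Q)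
    (d : E → ℝ) (hd : Differentiable ℝ d) (hdconv : ConvexOn ℝ Set.univ d)
    (V : E → E → ℝ)
    (hV : ∀ x y, V x y = d x - d y - ⟪gradient d y, x - y⟫)
    (f fδ : E → ℝ) (gδ : E → E) (δ L γ : ℝ)
    (hδ : 0 ≤ δ) (hL : 0 < L) (hγ1 : 1 < γ) (hγ2 : γ ≤ 2)
    (horacle : ∀ x ∈ Q, ∀ y ∈ Q,
      0 ≤ f x - fδ y - ⟪gδ y, x - y⟫ ∧
      f x - fδ y - ⟪gδ y, x - y⟫ ≤ L * V x y + δ)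
    (hTSP : ∀ x ∈ Q, ∀ z ∈ Q, ∀ z' ∈ Q, ∀ θ : ℝ, θ ∈ Set.Icc (0 : ℝ) 1 →
      V ((1 - θ) • x + θ • z) ((1 - θ) • x + θ • z') ≤ θ ^ γ * V z z')
    (θ : ℕ → ℝ) (hθ : ∀ k : ℕ, θ k = γ / ((k : ℝ) + γ))
    (xstar : E) (hstarQ : xstar ∈ Q) (hstarmin : ∀ x ∈ Q, f xstar ≤ f x)
    (N : ℕ) (hN : 1 ≤ N)
    (xs ys zs : ℕ → E)
    (hmemx : ∀ k ≤ N, xs k ∈ Q)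
    (hmemy : ∀ k < N, ys k ∈ Q)
    (hmemz : ∀ k ≤ N, zs k ∈ Q)
    (hz0 : zs 0 = xs 0)
    (hy : ∀ k < N, ys k = (1 - θ k) • xs k + θ k • zs k)
    (hzmin : ∀ k < N, ∀ z ∈ Q,
      fδ (ys k) + ⟪gδ (ys k), zs (k + 1) - ys k⟫ + θ k ^ (γ - 1) * L * V (zs (k + 1)) (zs k)
        ≤ fδ (ys k) + ⟪gδ (ys k), z - ys k⟫ + θ k ^ (γ - 1) * L * V z (zs k))
    (hx : ∀ k < N, xs (k + 1) = (1 - θ k) • xs k + θ k • zs (k + 1)) :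
    f (xs N) - f xstar ≤ (γ / (γ + (N : ℝ) - 1)) ^ γ * L * V xstar (xs 0) + δ * N := by
  have hθpos : ∀ k, 0 < θ k := fun k => by rw [hθ]; positivity
  have hθle : ∀ k, θ k ≤ 1 := fun k => by
    rw [hθ, div_le_one (by positivity)]
    linarith [k.cast_nonneg (α := ℝ)]
  have hdescent : ∀ k < N, f (xs (k + 1)) - f xstar ≤ (1 - θ k) * (f (xs k) - f xstar)
      + θ k ^ γ * L * (V xstar (zs k) - V xstar (zs (k + 1))) + δ := by
    intro k hk
    have hz : zs (k + 1) ∈ Q := hmemz (k + 1) hk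
    have hupper := (horacle _ (hmemx (k + 1) hk) _ (hmemy k hk)).2
    have hlower := (horacle _ (hmemx k hk.le) _ (hmemy k hk)).1
    have hlower' := (horacle _ hstarQ _ (hmemy k hk)).1
    have htsp := hTSP _ (hmemx k hk.le) _ hz _ (hmemz k hk.le) (θ k)
      ⟨(hθpos k).le, hθle k⟩
    rw [← hx k hk, ← hy k hk] at htsp
    have hthree := bregman_three_point hQconv hd hV (g := gδ (ys k)) (y := ys k) (q := zs k)
      (c := θ k ^ (γ - 1) * L) hz (fun z hzQ => by linarith [hzmin k hk z hzQ]) hstarQ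
    have hlin : ⟪gδ (ys k), xs (k + 1) - ys k⟫ = (1 - θ k) * ⟪gδ (ys k), xs k - ys k⟫
        + θ k * ⟪gδ (ys k), zs (k + 1) - ys k⟫ := by
      rw [show xs (k + 1) - ys k = (1 - θ k) • (xs k - ys k) + θ k • (zs (k + 1) - ys k) by
        rw [hx k hk]; module, inner_add_right, inner_smul_right, inner_smul_right]
    have hpow : θ k * θ k ^ (γ - 1) = θ k ^ γ := by
      rw [Real.rpow_sub_one (hθpos k).ne', mul_div_cancel₀ _ (hθpos k).ne']
    have hscaled := mul_le_mul_of_nonneg_left hthree (hθpos k).le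
    simp only [mul_add, ← mul_assoc, hpow] at hscaled
    have := mul_le_mul_of_nonneg_left htsp hL.le
    have := mul_nonneg (sub_nonneg.2 (hθle k)) hlower
    have := mul_nonneg (hθpos k).le hlower'
    linarith
  have hrate : ∀ k, k + 1 ≤ N → f (xs (k + 1)) - f xstar + θ k ^ γ * L * V xstar (zs (k + 1))
      ≤ θ k ^ γ * L * V xstar (xs 0) + δ * (k + 1) := by
    intro k
    induction k with
    | zero =>
      intro hk
      have hθ0 : θ 0 = 1 := by
        rw [hθ, Nat.cast_zero, zero_add, div_self (by linarith)]
      have hstep := hdescent 0 hk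
      rw [hθ0, hz0, Real.one_rpow] at hstep
      rw [hθ0, Real.one_rpow, Nat.cast_zero]
      linarith
    | succ k ih =>
      intro hk
      have hprev := ih (by omega)
      have hstep := hdescent (k + 1) hk
      have hgap := sub_nonneg.2 (hstarmin _ (hmemx (k + 1) (by omega)))
      have hp : 0 < θ k ^ γ := Real.rpow_pos_of_pos (hθpos k) γ
      have hratio : (1 - θ (k + 1)) * θ k ^ γ ≤ θ (k + 1) ^ γ := by
        have h := one_sub_div_mul_rpow_le hγ1 (k := ((k + 1 : ℕ) : ℝ)) (Nat.cast_nonneg _)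
        rwa [← hθ, show ((k + 1 : ℕ) : ℝ) + γ - 1 = k + γ by push_cast; ring, ← hθ] at h
      have hanti : θ (k + 1) ^ γ ≤ θ k ^ γ := by
        refine Real.rpow_le_rpow (hθpos _).le ?_ (by linarith)
        rw [hθ, hθ]
        gcongr
        simp
      obtain ⟨r, hr⟩ : ∃ r, θ (k + 1) ^ γ = r * θ k ^ γ :=
        ⟨_, (div_mul_cancel₀ _ hp.ne').symm⟩
      rw [hr] at hratio hanti hstep ⊢
      have hr1 : r ≤ 1 := by nlinarith
      have hr0 : 0 ≤ r := by
        have := Real.rpow_pos_of_pos (hθpos (k + 1)) γ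
        rw [hr] at this
        exact (pos_of_mul_pos_left this hp.le).le
      have hcontract := mul_le_mul_of_nonneg_right (le_of_mul_le_mul_right hratio hp) hgap
      have hscaled := mul_le_mul_of_nonneg_left hprev hr0
      have herr : r * (δ * (k + 1)) ≤ δ * (k + 1) :=
        mul_le_of_le_one_left (by positivity) hr1
      push_cast
      linarith
  obtain ⟨n, rfl⟩ : ∃ n, N = n + 1 := ⟨N - 1, by omega⟩
  have hfinal := hrate n le_rfl
  have hVnonneg : 0 ≤ V xstar (zs (n + 1)) := by
    rw [hV]
    exact hdconv.bregman_nonneg hd _ _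
  have := mul_nonneg (mul_pos (Real.rpow_pos_of_pos (hθpos n) γ) hL).le hVnonneg
  rw [show γ + ((n + 1 : ℕ) : ℝ) - 1 = n + γ by push_cast; ring, ← hθ]
  push_cast
  linarith
end

section
/- (AIBM convergence rate.) Let p ∈ [1,2], γ ∈ (1,2], k ≥ 0, L_0, …, L_k > 0, δ_0, …, δ_k ≥ 0, and R_0 > 0. Set q := (p−1)(γ−1), α_i := (1/L_i)·((i+2p)/(2p))^q, A_k := Σ_{i=0}^{k} α_i, and B_i := ((i+2p)/(2p))^{p−1}·α_i for 0 ≤ i ≤ k. Let f : Q → ℝ, y_k ∈ Q, and let x* ∈ Q minimize f over Q with d(x*) ≤ R_0. If f(y_k) − f(x*) ≤ d(x*)/A_k + (1/A_k)·Σ_{i=0}^{k} B_i·δ_i, then f(y_k) − f(x*) ≤ 16·R_0·(max_{0≤i≤k} L_i)/(k+2)^{q+1} + (k+2p)^{p−1}·(max_{0≤i≤k} δ_i). -/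
open RealInnerProductSpace

/-- A discrete mean value bound: for `q ≤ 1` and `1 < x`, the increment of `t ↦ t ^ (q + 1)` over
`[x - 1, x]` is at most `2 * x ^ q`. -/
lemma Real.rpow_add_one_le_sub_one_rpow_add {q x : ℝ} (hq1 : q ≤ 1) (hx : 1 < x) :
    x ^ (q + 1) ≤ (x - 1) ^ (q + 1) + 2 * x ^ q := by
  have hx0 : 0 < x := by linarith
  have hy0 : 0 < x - 1 := by linarith
  have hratio : (x - 1) / x ≤ ((x - 1) / x) ^ q :=
    Real.self_le_rpow_of_le_one (by positivity) ((div_le_one hx0).2 (by linarith)) hq1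
  rw [Real.div_rpow hy0.le hx0.le, div_le_div_iff₀ hx0 (Real.rpow_pos_of_pos hx0 q)] at hratio
  rw [Real.rpow_add_one hx0.ne', Real.rpow_add_one hy0.ne']
  have hxq : 0 < x ^ q := Real.rpow_pos_of_pos hx0 q
  refine le_of_mul_le_mul_right ?_ hx0
  nlinarith [mul_le_mul_of_nonneg_right hratio hy0.le]

/-- Lower bound on the sum of the unnormalized AIBM step coefficients. -/
lemma rpow_add_one_le_sum_rpow {p q : ℝ} (hp1 : 1 ≤ p) (hp2 : p ≤ 2) (hq0 : 0 ≤ q) (hq1 : q ≤ 1)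
    (k : ℕ) :
    ((k : ℝ) + 2) ^ (q + 1)
      ≤ 16 * ∑ i ∈ Finset.range (k + 1), (((i : ℝ) + 2 * p) / (2 * p)) ^ q := by
  have hp0 : 0 < p := by linarith
  induction k with
  | zero =>
    have h : (2 : ℝ) ^ (q + 1) ≤ 2 ^ (2 : ℝ) :=
      Real.rpow_le_rpow_of_exponent_le (by norm_num) (by linarith)
    norm_num at h
    simp [div_self (show 2 * p ≠ 0 by positivity)]
    linarith
  | succ k ih =>
    rw [Finset.sum_range_succ, mul_add]
    have hk : (0 : ℝ) ≤ k := k.cast_nonneg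
    have hstep := Real.rpow_add_one_le_sub_one_rpow_add hq1
      (show (1 : ℝ) < (k : ℝ) + 3 by linarith)
    have hquarter : (((k : ℝ) + 3) / 4) ^ q ≤ (((k : ℝ) + 1 + 2 * p) / (2 * p)) ^ q := by
      refine Real.rpow_le_rpow (by positivity) ?_ hq0
      rw [div_le_div_iff₀ (by norm_num) (by linarith)]
      nlinarith
    have h4 : (4 : ℝ) ^ q ≤ 4 := Real.rpow_le_self_of_one_le (by norm_num) hq1
    rw [Real.div_rpow (by linarith) (by norm_num)] at hquarter
    have hlow : ((k : ℝ) + 3) ^ q / 4 ≤ ((k : ℝ) + 3) ^ q / 4 ^ q := by gcongr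
    have hnonneg : 0 ≤ ((k : ℝ) + 3) ^ q := by positivity
    rw [show (k : ℝ) + 3 - 1 = k + 2 by ring] at hstep
    push_cast
    rw [show (k : ℝ) + 1 + 2 = k + 3 by ring]
    linarith

/-- Theorem 5.1 (AIBM convergence rate):
`f(y_k) − f(x*) ≤ 16·R_0·(max_i L_i)/(k+2)^{(p−1)(γ−1)+1} + (k+2p)^{p−1}·(max_i δ_i)`. -/
theorem stmt_13
    {E : Type*} [NormedAddCommGroup E] [InnerProductSpace ℝ E] [CompleteSpace E]
    (Q : Set E) (hQne : Q.Nonempty) (hQclosed : IsClosed Q) (hQconv : Convex ℝ Q)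
    (d : E → ℝ) (hd : Differentiable ℝ d) (hdconv : ConvexOn ℝ Set.univ d)
    (p γ : ℝ) (hp1 : 1 ≤ p) (hp2 : p ≤ 2) (hγ1 : 1 < γ) (hγ2 : γ ≤ 2)
    (k : ℕ) (L δ : ℕ → ℝ)
    (hL : ∀ i ≤ k, 0 < L i) (hδ : ∀ i ≤ k, 0 ≤ δ i)
    (R0 : ℝ) (hR0 : 0 < R0)
    (α B : ℕ → ℝ)
    (hα : ∀ i ≤ k, α i = (1 / L i) * (((i : ℝ) + 2 * p) / (2 * p)) ^ ((p - 1) * (γ - 1)))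
    (A : ℝ) (hA : A = ∑ i ∈ Finset.range (k + 1), α i)
    (hB : ∀ i ≤ k, B i = (((i : ℝ) + 2 * p) / (2 * p)) ^ (p - 1) * α i)
    (f : E → ℝ) (yk : E) (hyk : yk ∈ Q)
    (xstar : E) (hstarQ : xstar ∈ Q) (hstarmin : ∀ x ∈ Q, f xstar ≤ f x)
    (hdR0 : d xstar ≤ R0)
    (hkey : f yk - f xstar ≤ d xstar / A
        + (1 / A) * ∑ i ∈ Finset.range (k + 1), B i * δ i) :
    f yk - f xstar
      ≤ 16 * R0
          * ((Finset.range (k + 1)).sup' (Finset.nonempty_range_iff.mpr k.succ_ne_zero) L)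
          / ((k : ℝ) + 2) ^ ((p - 1) * (γ - 1) + 1)
        + ((k : ℝ) + 2 * p) ^ (p - 1)
          * ((Finset.range (k + 1)).sup' (Finset.nonempty_range_iff.mpr k.succ_ne_zero) δ) := by
  set hne := Finset.nonempty_range_iff.mpr k.succ_ne_zero
  set M := (Finset.range (k + 1)).sup' hne L
  set D := (Finset.range (k + 1)).sup' hne δ
  set q := (p - 1) * (γ - 1)
  have hp0 : 0 < p := by linarith
  have hq0 : 0 ≤ q := mul_nonneg (by linarith) (by linarith)
  have hq1 : q ≤ 1 := by nlinarith
  have hLM : ∀ i ≤ k, L i ≤ M := fun i hi =>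
    Finset.le_sup' L (Finset.mem_range.2 (Nat.lt_succ_of_le hi))
  have hδD : ∀ i ≤ k, δ i ≤ D := fun i hi =>
    Finset.le_sup' δ (Finset.mem_range.2 (Nat.lt_succ_of_le hi))
  have hM : 0 < M := (hL 0 k.zero_le).trans_le (hLM 0 k.zero_le)
  have hD : 0 ≤ D := (hδ 0 k.zero_le).trans (hδD 0 k.zero_le)
  have hα0 : ∀ i ≤ k, 0 < α i := fun i hi => by
    have := hL i hi
    rw [hα i hi]
    positivity
  have hA0 : 0 < A := hA ▸ Finset.sum_pos
    (fun i hi => hα0 i (Nat.le_of_lt_succ (Finset.mem_range.1 hi))) hne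
  have hSA : ∑ i ∈ Finset.range (k + 1), (((i : ℝ) + 2 * p) / (2 * p)) ^ q ≤ M * A := by
    rw [hA, Finset.mul_sum]
    refine Finset.sum_le_sum fun i hi => ?_
    have hik := Nat.le_of_lt_succ (Finset.mem_range.1 hi)
    rw [hα i hik, ← mul_assoc, mul_one_div]
    exact le_mul_of_one_le_left (by positivity) ((one_le_div (hL i hik)).2 (hLM i hik))
  have hprox : d xstar / A ≤ 16 * R0 * M / ((k : ℝ) + 2) ^ (q + 1) := by
    rw [div_le_div_iff₀ hA0 (by positivity)]
    have hsum := rpow_add_one_le_sum_rpow hp1 hp2 hq0 hq1 k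
    calc d xstar * ((k : ℝ) + 2) ^ (q + 1) ≤ R0 * ((k : ℝ) + 2) ^ (q + 1) := by gcongr
      _ ≤ R0 * (16 * (M * A)) := by gcongr; linarith
      _ = 16 * R0 * M * A := by ring
  have hnoise : (1 / A) * ∑ i ∈ Finset.range (k + 1), B i * δ i
      ≤ ((k : ℝ) + 2 * p) ^ (p - 1) * D := by
    rw [one_div, inv_mul_le_iff₀ hA0, hA, Finset.sum_mul]
    refine Finset.sum_le_sum fun i hi => ?_
    have hik := Nat.le_of_lt_succ (Finset.mem_range.1 hi)
    have hα' := (hα0 i hik).le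
    have hbase : (((i : ℝ) + 2 * p) / (2 * p)) ^ (p - 1) ≤ ((k : ℝ) + 2 * p) ^ (p - 1) := by
      refine Real.rpow_le_rpow (by positivity) ?_ (by linarith)
      exact (div_le_self (by positivity) (by linarith)).trans (by gcongr)
    calc B i * δ i = (((i : ℝ) + 2 * p) / (2 * p)) ^ (p - 1) * α i * δ i := by rw [hB i hik]
      _ ≤ ((k : ℝ) + 2 * p) ^ (p - 1) * α i * D :=
        mul_le_mul (by gcongr) (hδD i hik) (hδ i hik) (by positivity)
      _ = α i * (((k : ℝ) + 2 * p) ^ (p - 1) * D) := by ring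
  exact hkey.trans (add_le_add hprox hnoise)
end

section
/- (Universality of the adaptive fast gradient step.) Let f : Q → ℝ be differentiable with gradient ∇f, let L > 0, δ ≥ 0, and suppose f satisfies the relative Lipschitz-type inequality f(x) ≤ f(y) + ⟨∇f(y), x − y⟩ + L·V(x,y) + L·V(y,x) + δ for all x, y ∈ Q, and that V satisfies the triangular scaling property with factor γ = 2. Let L' ≥ L, A ≥ 0, α > 0 with A' := A + α = L'·α², let x_k, u ∈ Q, set y := (α·u + A·x_k)/A', let u' ∈ Q minimize x ↦ α·⟨∇f(y), x − y⟩ + V(x, u) over Q, and set x' := (α·u' + A·x_k)/A'. Then f(x') ≤ f(y) + δ. -/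
open RealInnerProductSpace

/-- A differentiable convex function lies above its tangent hyperplanes. -/
theorem ConvexOn.inner_gradient_le_sub {E : Type*} [NormedAddCommGroup E] [InnerProductSpace ℝ E]
    [CompleteSpace E] {d : E → ℝ} (hconv : ConvexOn ℝ Set.univ d) {y : E}
    (hd : DifferentiableAt ℝ d y) (x : E) : ⟪gradient d y, x - y⟫ ≤ d x - d y := by
  have hcomp : ConvexOn ℝ Set.univ (d ∘ (AffineMap.lineMap y x : ℝ →ᵃ[ℝ] E)) := by
    simpa using hconv.comp_affineMap (AffineMap.lineMap y x : ℝ →ᵃ[ℝ] E)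
  have hderiv : HasDerivAt (d ∘ (AffineMap.lineMap y x : ℝ →ᵃ[ℝ] E)) ⟪gradient d y, x - y⟫ 0 := by
    have hgrad : HasFDerivAt d (InnerProductSpace.toDual ℝ E (gradient d y))
        (AffineMap.lineMap y x (0 : ℝ)) := by
      simpa using hd.hasGradientAt.hasFDerivAt
    simpa using hgrad.comp_hasDerivAt (0 : ℝ) AffineMap.hasDerivAt_lineMap
  simpa [slope_def_field] using
    hcomp.le_slope_of_hasDerivAt (Set.mem_univ 0) (Set.mem_univ 1) one_pos hderiv

/-- First-order optimality: at a minimizer over a convex set, the gradient makes a nonnegative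
inner product with every feasible direction. -/
theorem IsMinOn.inner_gradient_nonneg {E : Type*} [NormedAddCommGroup E] [InnerProductSpace ℝ E]
    [CompleteSpace E] {Q : Set E} (hQ : Convex ℝ Q) {h : E → ℝ} {g w : E} (hmin : IsMinOn h Q w)
    (hw : w ∈ Q) (hg : HasGradientAt h g w) {x : E} (hx : x ∈ Q) : 0 ≤ ⟪g, x - w⟫ := by
  simpa using hmin.localize.hasFDerivWithinAt_nonneg hg.hasFDerivAt.hasFDerivWithinAt
    (sub_mem_posTangentConeAt_of_segment_subset (hQ.segment_subset hw hx))

/-- Remark 3.1 (universality of the adaptive fast gradient step): for a relatively Lipschitz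
continuous function, the fast-gradient step satisfies `f(x') ≤ f(y) + δ`. -/
theorem stmt_14
    {E : Type*} [NormedAddCommGroup E] [InnerProductSpace ℝ E] [CompleteSpace E]
    (Q : Set E) (hQne : Q.Nonempty) (hQclosed : IsClosed Q) (hQconv : Convex ℝ Q)
    (d : E → ℝ) (hd : Differentiable ℝ d) (hdconv : ConvexOn ℝ Set.univ d)
    (V : E → E → ℝ)
    (hV : ∀ x y, V x y = d x - d y - ⟪gradient d y, x - y⟫)
    (f : E → ℝ) (hf : Differentiable ℝ f)
    (L δ : ℝ) (hL : 0 < L) (hδ : 0 ≤ δ)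
    (hrelLip : ∀ x ∈ Q, ∀ y ∈ Q,
      f x ≤ f y + ⟪gradient f y, x - y⟫ + L * V x y + L * V y x + δ)
    (hTSP : ∀ x ∈ Q, ∀ z ∈ Q, ∀ z' ∈ Q, ∀ θ : ℝ, θ ∈ Set.Icc (0 : ℝ) 1 →
      V ((1 - θ) • x + θ • z) ((1 - θ) • x + θ • z') ≤ θ ^ (2 : ℝ) * V z z')
    (L' : ℝ) (hL' : L ≤ L')
    (A α A' : ℝ) (hA : 0 ≤ A) (hα : 0 < α)
    (hA' : A' = A + α) (hA'L : A' = L' * α ^ 2)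
    (xk u : E) (hxk : xk ∈ Q) (hu : u ∈ Q)
    (y : E) (hy : y = A'⁻¹ • (α • u + A • xk))
    (u' : E) (hu'Q : u' ∈ Q)
    (hu'min : ∀ x ∈ Q,
      α * ⟪gradient f y, u' - y⟫ + V u' u ≤ α * ⟪gradient f y, x - y⟫ + V x u)
    (x' : E) (hx' : x' = A'⁻¹ • (α • u' + A • xk)) :
    f x' ≤ f y + δ := by
  have hA'pos : 0 < A' := by linarith
  set g := gradient f y with hg
  have hopt : 0 ≤ ⟪α • g + gradient d u' - gradient d u, u - u'⟫ := by
    refine IsMinOn.inner_gradient_nonneg hQconv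
      (h := fun x => α * ⟪g, x - y⟫ + V x u) (fun x hx => hu'min x hx) hu'Q ?_ hu
    have hlin (a b : E) : HasFDerivAt (fun x => ⟪a, x - b⟫) (innerSL ℝ a) u' :=
      (innerSL ℝ a).hasFDerivAt.comp u' ((hasFDerivAt_id u').sub_const b)
    have hsum := ((hlin g y).const_mul α).add
      (((hd u').hasGradientAt.hasFDerivAt.sub_const (d u)).sub (hlin (gradient d u) u))
    rw [hasGradientAt_iff_hasFDerivAt]
    simp only [hV]
    refine hsum.congr_fderiv ?_
    ext v
    simp
    ring
  have hsym : V u' u + V u u' = ⟪gradient d u' - gradient d u, u' - u⟫ := by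
    simp only [hV, inner_sub_left, inner_sub_right]
    ring
  have hthree : α * ⟪g, u' - u⟫ + (V u' u + V u u') ≤ 0 := by
    rw [hsym]
    simp only [inner_add_left, inner_sub_left, inner_sub_right, real_inner_smul_left] at hopt ⊢
    linarith
  have hnonneg (a b : E) : 0 ≤ V a b := by
    rw [hV]
    linarith [hdconv.inner_gradient_le_sub (hd b) a]
  have hθ : α / A' ∈ Set.Icc (0 : ℝ) 1 := ⟨by positivity, (div_le_one hA'pos).2 (by linarith)⟩
  have hcomb (z : E) : A'⁻¹ • (α • z + A • xk) = (1 - α / A') • xk + (α / A') • z := by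
    have hcoef : 1 - α / A' = A'⁻¹ * A := by
      field_simp
      linarith
    rw [hcoef, smul_add, smul_smul, smul_smul, add_comm, div_eq_inv_mul]
  rw [hcomb] at hy hx'
  have hmem {z : E} (hz : z ∈ Q) : (1 - α / A') • xk + (α / A') • z ∈ Q :=
    hQconv hxk hz (sub_nonneg.2 hθ.2) hθ.1 (by ring)
  have hVle := hTSP xk hxk u' hu'Q u hu _ hθ
  have hVle' := hTSP xk hxk u hu u' hu'Q _ hθ
  rw [← hx', ← hy, Real.rpow_two] at hVle hVle'
  have hstep := hrelLip x' (hx' ▸ hmem hu'Q) y (hy ▸ hmem hu)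
  have hinner : ⟪g, x' - y⟫ = α / A' * ⟪g, u' - u⟫ := by
    have hdiff : x' - y = (α / A') • (u' - u) := by
      rw [hx', hy, smul_sub]
      abel
    rw [hdiff, real_inner_smul_right]
  have hscale : L' * (α / A') ^ 2 = A'⁻¹ := by
    rw [div_pow, ← mul_div_assoc, ← hA'L]
    field_simp
  have hS : 0 ≤ V u' u + V u u' := add_nonneg (hnonneg _ _) (hnonneg _ _)
  have hbregman : L * V x' y + L * V y x' ≤ A'⁻¹ * (V u' u + V u u') :=
    calc L * V x' y + L * V y x' ≤ L * (α / A') ^ 2 * (V u' u + V u u') := by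
          nlinarith
      _ ≤ L' * (α / A') ^ 2 * (V u' u + V u u') := by gcongr
      _ = A'⁻¹ * (V u' u + V u u') := by rw [hscale]
  have hdescent : A'⁻¹ * (α * ⟪g, u' - u⟫ + (V u' u + V u u')) ≤ 0 :=
    mul_nonpos_of_nonneg_of_nonpos (by positivity) hthree
  rw [← hg, hinner, div_eq_inv_mul] at hstep
  linarith
end
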